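/- arXiv:math/0403362 — 3 statements merged into one kernel-verified Lean document; each statement's English description precedes it below -/
import Mathlib

section
/- Let T₁ : H₁ → H₂ and T₂ : H₂ → H₃ be as in the context, with range(T₁) ⊆ ker(T₂). Then the following are equivalent: (i) there exists a constant c > 0 such that ‖T₁*u‖² + ‖T₂u‖² ≥ c‖u‖² for all u ∈ dom(T₁*) ∩ dom(T₂); (ii) range(T₂) is closed in H₃ and range(T₁) = ker(T₂). -/
open scoped LinearPMap

section Helpers

variable {E F G : Type*}
  [NormedAddCommGroup E] [InnerProductSpace ℂ E] [CompleteSpace E]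
  [NormedAddCommGroup F] [InnerProductSpace ℂ F] [CompleteSpace F]

/-- `T** ⊆ T` for closed densely defined `T`. -/
lemma mem_graph_of_forall_adjoint (T : E →ₗ.[ℂ] F) (hd : Dense (T.domain : Set E))
    (hc : T.IsClosed) (w : E) (u : F)
    (h : ∀ v : T†.domain, inner ℂ (T† v) w = inner ℂ (v : F) u) : (w, u) ∈ T.graph := by
  let e := WithLp.prodContinuousLinearEquiv 2 ℂ E F
  let K : Submodule ℂ (WithLp 2 (E × F)) := T.graph.comap e.toLinearEquiv.toLinearMap
  have hK : IsClosed (K : Set (WithLp 2 (E × F))) := by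
    have : (K : Set (WithLp 2 (E × F))) = e ⁻¹' (T.graph : Set (E × F)) := rfl
    rw [this]
    exact IsClosed.preimage e.continuous hc
  have : CompleteSpace K := hK.completeSpace_coe
  have hmem : WithLp.toLp 2 (w, u) ∈ Kᗮᗮ := by
    rw [Submodule.mem_orthogonal]
    intro p hp
    rw [Submodule.mem_orthogonal'] at hp
    have hp' : ∀ x : T.domain, inner ℂ (-p.fst) (x : E) = inner ℂ p.snd (T x) := by
      intro x
      have := hp (WithLp.toLp 2 ((x : E), T x)) (T.mem_graph x)
      simp only [WithLp.prod_inner_apply] at this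
      rw [inner_neg_left]
      exact neg_eq_of_add_eq_zero_right this
    have hdom : p.snd ∈ T†.domain :=
      LinearPMap.mem_adjoint_domain_of_exists _ ⟨_, hp'⟩
    have happ := LinearPMap.adjoint_apply_eq hd ⟨p.snd, hdom⟩ hp'
    have := h ⟨p.snd, hdom⟩
    rw [happ, inner_neg_left] at this
    simp only [WithLp.prod_inner_apply]
    change inner ℂ p.fst w + inner ℂ p.snd u = 0
    rw [← this]; simp
  rw [Submodule.orthogonal_orthogonal] at hmem
  exact hmem

/-- Open mapping: an operator with closed range has bounded preimages. -/
lemma exists_bounded_preimage (T : E →ₗ.[ℂ] F) (hc : T.IsClosed)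
    (hr : IsClosed ((LinearMap.range T.toFun : Submodule ℂ F) : Set F)) :
    ∃ C > (0 : ℝ), ∀ x : T.domain, ∃ x' : T.domain, T x' = T x ∧ ‖(x' : E)‖ ≤ C * ‖T x‖ := by
  have hg : IsClosed (T.graph : Set (E × F)) := hc
  have : CompleteSpace T.graph := hg.completeSpace_coe
  have : CompleteSpace (LinearMap.range T.toFun) := hr.completeSpace_coe
  let f : T.graph →L[ℂ] (LinearMap.range T.toFun) :=
    ((ContinuousLinearMap.snd ℂ E F).comp T.graph.subtypeL).codRestrict _ (by
      rintro ⟨p, hp⟩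
      obtain ⟨y, -, hy⟩ := (T.mem_graph_iff).1 hp
      exact ⟨y, hy⟩)
  have hf : Function.Surjective f := by
    rintro ⟨_, ⟨x, rfl⟩⟩
    exact ⟨⟨_, T.mem_graph x⟩, rfl⟩
  obtain ⟨C, hC, h⟩ := f.exists_preimage_norm_le hf
  refine ⟨C, hC, fun x => ?_⟩
  obtain ⟨⟨p, hp⟩, hfp, hn⟩ := h ⟨T x, ⟨x, rfl⟩⟩
  obtain ⟨y, hy1, hy2⟩ := (T.mem_graph_iff).1 hp
  refine ⟨y, ?_, ?_⟩
  · rw [hy2]; exact congrArg Subtype.val hfp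
  · rw [hy1]; exact (norm_fst_le p).trans hn

/-- Riesz representation of a functional dominated by a linear map. -/
lemma exists_riesz {D : Type*} [AddCommGroup D] [Module ℂ D] (S : D →ₗ[ℂ] E) (φ : D →ₗ[ℂ] ℂ)
    (C : ℝ) (h : ∀ v, ‖φ v‖ ≤ C * ‖S v‖) : ∃ w : E, ∀ v, inner ℂ w (S v) = φ v := by
  obtain ⟨g, hg⟩ := S.rangeRestrict.exists_rightInverse_of_surjective S.range_rangeRestrict
  have hSg : ∀ y, S (g y) = y := fun y => congrArg Subtype.val (LinearMap.congr_fun hg y)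
  let f : StrongDual ℂ (LinearMap.range S) := (φ.comp g).mkContinuous C (by
    intro y
    have := h (g y)
    rw [hSg] at this
    exact this)
  obtain ⟨k, hk, -⟩ := exists_extension_norm_eq _ f
  refine ⟨(InnerProductSpace.toDual ℂ E).symm k, fun v => ?_⟩
  rw [InnerProductSpace.toDual_symm_apply]
  have h1 := hk ⟨S v, ⟨v, rfl⟩⟩
  rw [h1]
  change φ (g ⟨S v, _⟩) = φ v
  have h2 := h (g ⟨S v, ⟨v, rfl⟩⟩ - v)
  rw [map_sub, map_sub, hSg] at h2
  simp only [sub_self, norm_zero, mul_zero] at h2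
  exact sub_eq_zero.1 (norm_le_zero_iff.1 h2)

lemma mem_kerMap (T : E →ₗ.[ℂ] F) (u : E) :
    u ∈ (LinearMap.ker T.toFun).map T.domain.subtype ↔ ∃ h : u ∈ T.domain, T ⟨u, h⟩ = 0 := by
  constructor
  · rintro ⟨y, hy, rfl⟩
    exact ⟨y.2, hy⟩
  · rintro ⟨h, h0⟩
    exact ⟨⟨u, h⟩, h0, rfl⟩

lemma isClosed_kerMap (T : E →ₗ.[ℂ] F) (hc : T.IsClosed) :
    IsClosed (((LinearMap.ker T.toFun).map T.domain.subtype : Submodule ℂ E) : Set E) := by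
  have : (((LinearMap.ker T.toFun).map T.domain.subtype : Submodule ℂ E) : Set E) =
      (fun u : E => (u, (0 : F))) ⁻¹' (T.graph : Set (E × F)) := by
    ext u
    simp only [SetLike.mem_coe, Set.mem_preimage, mem_kerMap, LinearPMap.mem_graph_iff]
    constructor
    · rintro ⟨h, h0⟩
      exact ⟨⟨u, h⟩, rfl, h0⟩
    · rintro ⟨⟨y, hy⟩, rfl, h0⟩
      exact ⟨hy, h0⟩
  rw [this]
  exact IsClosed.preimage (by fun_prop) hc

/-- Bounded below on the orthocomplement of the kernel implies closed range. -/
lemma isClosed_range_of_bound (T : E →ₗ.[ℂ] F) (hc : T.IsClosed) (C : ℝ)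
    (h : ∀ x : T.domain, (x : E) ∈ ((LinearMap.ker T.toFun).map T.domain.subtype)ᗮ →
      ‖(x : E)‖ ≤ C * ‖T x‖) :
    IsClosed ((LinearMap.range T.toFun : Submodule ℂ F) : Set F) := by
  set N := (LinearMap.ker T.toFun).map T.domain.subtype with hN
  have : CompleteSpace N := (isClosed_kerMap T hc).completeSpace_coe
  let K : Submodule ℂ (E × F) := T.graph ⊓ Nᗮ.comap (LinearMap.fst ℂ E F)
  have hK : IsClosed (K : Set (E × F)) :=
    IsClosed.inter hc (N.isClosed_orthogonal.preimage continuous_fst)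
  have : CompleteSpace K := hK.completeSpace_coe
  let f : K →L[ℂ] F := (ContinuousLinearMap.snd ℂ E F).comp K.subtypeL
  have hf : AntilipschitzWith (max C 1).toNNReal f := by
    refine AddMonoidHomClass.antilipschitz_of_bound f ?_
    rintro ⟨p, hp1, hp2⟩
    obtain ⟨y, hy1, hy2⟩ := (T.mem_graph_iff).1 hp1
    rw [Real.coe_toNNReal _ (le_max_of_le_right zero_le_one)]
    change ‖p‖ ≤ _ * ‖p.2‖
    have := h y (by rw [hy1]; exact hp2)
    rw [hy1, hy2] at this
    rw [Prod.norm_def]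
    refine max_le (this.trans ?_) ?_
    · gcongr; exact le_max_left _ _
    · exact le_mul_of_one_le_left (norm_nonneg _) (le_max_right _ _)
  have hcl := hf.isClosed_range f.uniformContinuous
  convert hcl using 1
  ext y
  constructor
  · rintro ⟨x, rfl⟩
    have hm := N.starProjection_apply_mem (x : E)
    have ho := N.sub_starProjection_mem_orthogonal (x : E)
    obtain ⟨hd, h0⟩ := (mem_kerMap T _).1 hm
    refine ⟨⟨(((x - ⟨_, hd⟩ : T.domain) : E), T (x - ⟨_, hd⟩)), T.mem_graph _, ho⟩, ?_⟩
    change T (x - ⟨_, hd⟩) = T x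
    rw [LinearPMap.map_sub, h0, sub_zero]
  · rintro ⟨⟨p, hp1, hp2⟩, rfl⟩
    obtain ⟨y, hy1, hy2⟩ := (T.mem_graph_iff).1 hp1
    exact ⟨y, hy2⟩

end Helpers

/-- For densely defined closed operators `T₁ : H₁ → H₂`, `T₂ : H₂ → H₃`
between complex Hilbert spaces with `range T₁ ⊆ ker T₂`, the basic estimate
`‖T₁*u‖² + ‖T₂u‖² ≥ c‖u‖²` on `dom T₁* ∩ dom T₂` holds for some `c > 0` if and only if
`range T₂` is closed and `range T₁ = ker T₂`. -/
theorem spectral_lemma_part_one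
    {H₁ H₂ H₃ : Type*}
    [NormedAddCommGroup H₁] [InnerProductSpace ℂ H₁] [CompleteSpace H₁]
    [NormedAddCommGroup H₂] [InnerProductSpace ℂ H₂] [CompleteSpace H₂]
    [NormedAddCommGroup H₃] [InnerProductSpace ℂ H₃] [CompleteSpace H₃]
    (T₁ : H₁ →ₗ.[ℂ] H₂) (T₂ : H₂ →ₗ.[ℂ] H₃)
    (hT₁dense : Dense (T₁.domain : Set H₁)) (hT₂dense : Dense (T₂.domain : Set H₂))
    (hT₁closed : T₁.IsClosed) (hT₂closed : T₂.IsClosed)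
    (hrange : LinearMap.range T₁.toFun ≤
      (LinearMap.ker T₂.toFun).map T₂.domain.subtype) :
    (∃ c > (0 : ℝ), ∀ (u : H₂) (h1 : u ∈ T₁†.domain) (h2 : u ∈ T₂.domain),
        c * ‖u‖ ^ 2 ≤ ‖T₁† ⟨u, h1⟩‖ ^ 2 + ‖T₂ ⟨u, h2⟩‖ ^ 2) ↔
      (IsClosed ((LinearMap.range T₂.toFun : Submodule ℂ H₃) : Set H₃) ∧
        LinearMap.range T₁.toFun = (LinearMap.ker T₂.toFun).map T₂.domain.subtype) := by
  set N := (LinearMap.ker T₂.toFun).map T₂.domain.subtype with hN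
  have hNc : IsClosed (N : Set H₂) := isClosed_kerMap T₂ hT₂closed
  have : CompleteSpace N := hNc.completeSpace_coe
  have hadj := LinearPMap.adjoint_isFormalAdjoint hT₁dense
  constructor
  · rintro ⟨c, hc, hest⟩
    -- vectors orthogonal to `N` lie in the kernel of `T₁*`
    have hperp : ∀ u ∈ Nᗮ, ∃ h : u ∈ T₁†.domain, T₁† ⟨u, h⟩ = 0 := by
      intro u hu
      have key : ∀ x : T₁.domain, inner ℂ (0 : H₁) (x : H₁) = inner ℂ u (T₁ x) := by
        intro x
        rw [inner_zero_left]
        exact (Submodule.inner_left_of_mem_orthogonal (hrange ⟨x, rfl⟩) hu).symm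
      have hd : u ∈ T₁†.domain := LinearPMap.mem_adjoint_domain_of_exists _ ⟨_, key⟩
      exact ⟨hd, LinearPMap.adjoint_apply_eq hT₁dense ⟨u, hd⟩ key⟩
    have hroot : ∀ a b : ℝ, 0 ≤ a → 0 ≤ b → c * a ^ 2 ≤ b ^ 2 → a ≤ (√c)⁻¹ * b := by
      intro a b ha hb hab
      rw [inv_mul_eq_div, le_div_iff₀ (Real.sqrt_pos.2 hc)]
      refine le_of_sq_le_sq ?_ hb
      rw [mul_pow, Real.sq_sqrt hc.le]; linarith
    refine ⟨isClosed_range_of_bound T₂ hT₂closed (√c)⁻¹ ?_, le_antisymm hrange ?_⟩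
    · intro x hx
      obtain ⟨hd, h0⟩ := hperp x hx
      have := hest x hd x.2
      rw [h0] at this
      refine hroot _ _ (norm_nonneg _) (norm_nonneg _) ?_
      simpa using this
    · intro u hu
      have hb : ∀ v : T₁†.domain, ‖(innerₛₗ ℂ u) (v : H₂)‖ ≤ (‖u‖ * (√c)⁻¹) * ‖T₁† v‖ := by
        intro v
        have hm := N.starProjection_apply_mem (v : H₂)
        have ho := N.sub_starProjection_mem_orthogonal (v : H₂)
        obtain ⟨hd2, h20⟩ := (mem_kerMap T₂ _).1 hm
        obtain ⟨hd1, h10⟩ := hperp _ ho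
        have hd : N.starProjection (v : H₂) ∈ T₁†.domain := by
          have := T₁†.domain.sub_mem v.2 hd1
          simpa using this
        have heq : T₁† ⟨_, hd⟩ = T₁† v := by
          have : v = ⟨_, hd⟩ + ⟨_, hd1⟩ := by
            ext; simp
          conv_rhs => rw [this]
          rw [LinearPMap.map_add, h10, add_zero]
        have he := hest _ hd hd2
        rw [heq, h20] at he
        have hn := hroot ‖N.starProjection (v : H₂)‖ ‖T₁† v‖ (norm_nonneg _) (norm_nonneg _)
          (by simpa using he)
        have hin : inner ℂ u (v : H₂) = inner ℂ u (N.starProjection (v : H₂)) := by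
          have := Submodule.inner_right_of_mem_orthogonal hu ho
          rw [inner_sub_right] at this
          exact sub_eq_zero.1 this
        rw [innerₛₗ_apply_apply, hin, mul_assoc]
        exact (norm_inner_le_norm _ _).trans (by gcongr)
      obtain ⟨w, hw⟩ := exists_riesz T₁†.toFun ((innerₛₗ ℂ u).comp T₁†.domain.subtype) _ hb
      have hg := mem_graph_of_forall_adjoint T₁ hT₁dense hT₁closed w u (by
        intro v
        have := hw v
        change inner ℂ w (T₁† v) = inner ℂ u (v : H₂) at this
        rw [← inner_conj_symm, this, inner_conj_symm])
      obtain ⟨y, -, hy⟩ := (T₁.mem_graph_iff).1 hg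
      exact ⟨y, hy⟩
  · rintro ⟨hcl, heq⟩
    obtain ⟨C₂, hC₂, h2⟩ := exists_bounded_preimage T₂ hT₂closed hcl
    obtain ⟨C₁, hC₁, h1⟩ := exists_bounded_preimage T₁ hT₁closed (by rw [heq]; exact hNc)
    have hcancel : ∀ a b : ℝ, 0 ≤ a → 0 ≤ b → a ^ 2 ≤ a * b → a ≤ b := by
      intro a b ha hb hab
      rcases ha.eq_or_lt with h | h
      · rw [← h]; exact hb
      · exact le_of_mul_le_mul_left (by rwa [sq] at hab) h
    refine ⟨(C₁ ^ 2 + C₂ ^ 2)⁻¹, by positivity, fun u hu1 hu2 => ?_⟩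
    set p := N.starProjection u with hp
    have hm : p ∈ N := N.starProjection_apply_mem u
    have ho : u - p ∈ Nᗮ := N.sub_starProjection_mem_orthogonal u
    have hpo : inner ℂ p (u - p) = 0 := Submodule.inner_right_of_mem_orthogonal hm ho
    have hpyth : ‖u‖ ^ 2 = ‖p‖ ^ 2 + ‖u - p‖ ^ 2 := by
      have := norm_add_sq_eq_norm_sq_add_norm_sq_of_inner_eq_zero p (u - p) hpo
      rw [add_sub_cancel] at this
      simpa [sq] using this
    have hb2 : ‖u - p‖ ≤ C₂ * ‖T₂ ⟨u, hu2⟩‖ := by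
      obtain ⟨x, hx, hxn⟩ := h2 ⟨u, hu2⟩
      refine le_trans ?_ hxn
      have hxN : u - x ∈ N := (mem_kerMap T₂ _).2 ⟨T₂.domain.sub_mem hu2 x.2, by
        change T₂ (⟨u, hu2⟩ - x) = 0
        rw [LinearPMap.map_sub, hx, sub_self]⟩
      refine hcancel _ _ (norm_nonneg _) (norm_nonneg _) ?_
      have e1 : inner ℂ (u - p) (x : H₂) = inner ℂ (u - p) (u - p) := by
        have : (x : H₂) = (u - p) - ((u - x) - p) := by abel
        conv_lhs => rw [this]
        rw [inner_sub_right, Submodule.inner_left_of_mem_orthogonal (N.sub_mem hxN hm) ho, sub_zero]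
      have := norm_inner_le_norm (𝕜 := ℂ) (u - p) (x : H₂)
      rw [e1, inner_self_eq_norm_sq_to_K] at this
      simpa using this
    have hb1 : ‖p‖ ≤ C₁ * ‖T₁† ⟨u, hu1⟩‖ := by
      have hpr : p ∈ LinearMap.range T₁.toFun := by rw [heq]; exact hm
      obtain ⟨y, hy⟩ := hpr
      obtain ⟨x, hx, hxn⟩ := h1 y
      change T₁ y = p at hy
      rw [hy] at hx hxn
      refine hcancel _ _ (norm_nonneg _) (by positivity) ?_
      have e1 : inner ℂ (T₁† ⟨u, hu1⟩) (x : H₁) = inner ℂ p p := by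
        rw [hadj ⟨u, hu1⟩ x, hx]
        change inner ℂ u p = _
        have := Submodule.inner_left_of_mem_orthogonal hm ho
        rw [inner_sub_left] at this
        exact sub_eq_zero.1 this
      have := norm_inner_le_norm (𝕜 := ℂ) (T₁† ⟨u, hu1⟩) (x : H₁)
      rw [e1, inner_self_eq_norm_sq_to_K] at this
      have h3 : ‖p‖ ^ 2 ≤ ‖T₁† ⟨u, hu1⟩‖ * ‖(x : H₁)‖ := by simpa using this
      calc ‖p‖ ^ 2 ≤ ‖T₁† ⟨u, hu1⟩‖ * ‖(x : H₁)‖ := h3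
        _ ≤ ‖T₁† ⟨u, hu1⟩‖ * (C₁ * ‖p‖) := by gcongr
        _ = _ := by ring
    rw [inv_mul_le_iff₀ (by positivity), hpyth]
    have q1 : ‖p‖ ^ 2 ≤ C₁ ^ 2 * ‖T₁† ⟨u, hu1⟩‖ ^ 2 := by
      rw [← mul_pow]; gcongr
    have q2 : ‖u - p‖ ^ 2 ≤ C₂ ^ 2 * ‖T₂ ⟨u, hu2⟩‖ ^ 2 := by
      rw [← mul_pow]; gcongr
    have q3 : 0 ≤ C₁ ^ 2 * ‖T₂ ⟨u, hu2⟩‖ ^ 2 := by positivity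
    have q4 : 0 ≤ C₂ ^ 2 * ‖T₁† ⟨u, hu1⟩‖ ^ 2 := by positivity
    linarith
end

section
/- Let T₁ : H₁ → H₂ and T₂ : H₂ → H₃ be as in the context, with range(T₁) ⊆ ker(T₂). Then the following are equivalent: (i) there exist a constant c > 0 and a finite-dimensional subspace L ⊆ dom(T₁*) ∩ dom(T₂) such that ‖T₁*u‖² + ‖T₂u‖² ≥ c‖u‖² for all u ∈ dom(T₁*) ∩ dom(T₂) ∩ L^⊥; (ii) there exists a finite-dimensional subspace L ⊆ dom(T₁*) ∩ dom(T₂) such that the range of the restriction of T₂ to dom(T₂) ∩ L^⊥ is closed in H₃ and range(T₁) ∩ L^⊥ = ker(T₂) ∩ L^⊥. -/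
open scoped LinearPMap

section SpectralAux

variable {E F H₁ H₂ H₃ : Type*}
  [NormedAddCommGroup E] [NormedSpace ℂ E] [CompleteSpace E]
  [NormedAddCommGroup F] [NormedSpace ℂ F] [CompleteSpace F]
  [NormedAddCommGroup H₁] [InnerProductSpace ℂ H₁] [CompleteSpace H₁]
  [NormedAddCommGroup H₂] [InnerProductSpace ℂ H₂] [CompleteSpace H₂]
  [NormedAddCommGroup H₃] [InnerProductSpace ℂ H₃] [CompleteSpace H₃]

/-- Open mapping theorem for closed linear relations with closed range. -/
theorem aux_open (G : Submodule ℂ (E × F)) (hG : IsClosed (G : Set (E × F)))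
    (hR : IsClosed ((G.map (LinearMap.snd ℂ E F) : Submodule ℂ F) : Set F)) :
    ∃ C > (0 : ℝ), ∀ x y, (x, y) ∈ G → ∃ x', (x', y) ∈ G ∧ ‖x'‖ ≤ C * ‖y‖ := by
  have : CompleteSpace G := hG.completeSpace_coe
  have : CompleteSpace (G.map (LinearMap.snd ℂ E F)) := hR.completeSpace_coe
  let f : G →L[ℂ] (G.map (LinearMap.snd ℂ E F)) :=
    ((ContinuousLinearMap.snd ℂ E F).comp G.subtypeL).codRestrict _
      (fun p => ⟨p.1, p.2, rfl⟩)
  have hf : Function.Surjective f := by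
    rintro ⟨y, p, hp, rfl⟩
    exact ⟨⟨p, hp⟩, rfl⟩
  obtain ⟨C, hC, h⟩ := f.exists_preimage_norm_le hf
  refine ⟨C, hC, fun x y hxy => ?_⟩
  obtain ⟨⟨⟨x', y'⟩, hp⟩, h1, h2⟩ := h ⟨y, (x, y), hxy, rfl⟩
  have : y' = y := congrArg Subtype.val h1
  subst this
  exact ⟨x', hp, (norm_fst_le (x', y')).trans h2⟩

/-- A closed linear relation that is bounded below has closed range. -/
theorem aux_closed (G : Submodule ℂ (E × F)) (hG : IsClosed (G : Set (E × F)))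
    (C : ℝ) (hC : ∀ x y, (x, y) ∈ G → ‖x‖ ≤ C * ‖y‖) :
    IsClosed ((G.map (LinearMap.snd ℂ E F) : Submodule ℂ F) : Set F) := by
  have : CompleteSpace G := hG.completeSpace_coe
  let f : G →L[ℂ] F := (ContinuousLinearMap.snd ℂ E F).comp G.subtypeL
  have ha : AntilipschitzWith (max C 1).toNNReal f := by
    refine AddMonoidHomClass.antilipschitz_of_bound f ?_
    rintro ⟨⟨x, y⟩, hp⟩
    have h1 := hC x y hp
    have h2 : (0 : ℝ) ≤ max C 1 := le_max_of_le_right zero_le_one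
    rw [Real.coe_toNNReal _ h2]
    change max ‖x‖ ‖y‖ ≤ max C 1 * ‖y‖
    refine max_le (h1.trans ?_) ?_
    · gcongr
      exact le_max_left _ _
    · exact le_mul_of_one_le_left (norm_nonneg _) (le_max_right _ _)
  have := ha.isClosed_range f.uniformContinuous
  convert this using 1
  ext y
  constructor
  · rintro ⟨p, hp, rfl⟩
    exact ⟨⟨p, hp⟩, rfl⟩
  · rintro ⟨p, rfl⟩
    exact ⟨p.1, p.2, rfl⟩

theorem aux_double (A : Submodule ℂ (H₁ × H₂)) (hA : IsClosed (A : Set (H₁ × H₂)))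
    (g : H₁) (f : H₂)
    (h : ∀ v a, (∀ x y, (x, y) ∈ A → inner ℂ y v = inner ℂ x a) →
      inner ℂ f v = inner ℂ g a) : (g, f) ∈ A := by
  let e := (WithLp.linearEquiv 2 ℂ (H₁ × H₂))
  let G : Submodule ℂ (WithLp 2 (H₁ × H₂)) := A.comap e.toLinearMap
  have hG : IsClosed (G : Set (WithLp 2 (H₁ × H₂))) :=
    hA.preimage (WithLp.prod_continuous_ofLp 2 H₁ H₂)
  have : CompleteSpace G := hG.completeSpace_coe
  have key : WithLp.toLp 2 (g, f) ∈ Gᗮᗮ := by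
    rw [Submodule.mem_orthogonal']
    intro w hw
    rw [Submodule.mem_orthogonal] at hw
    have := h w.snd (-w.fst) (by
      intro x y hxy
      have := hw (WithLp.toLp 2 (x, y)) hxy
      simp only [WithLp.prod_inner_apply] at this
      rw [inner_neg_right]
      exact eq_neg_of_add_eq_zero_right this)
    rw [WithLp.prod_inner_apply]
    rw [inner_neg_right] at this
    change inner ℂ g w.fst + inner ℂ f w.snd = 0
    rw [this, add_neg_cancel]
  rw [Submodule.orthogonal_orthogonal] at key
  exact key

theorem aux_solve (A : Submodule ℂ (H₁ × H₂)) (hA : IsClosed (A : Set (H₁ × H₂)))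
    (f : H₂) (C : ℝ)
    (h : ∀ v a, (v, a) ∈ A.adjoint → ‖inner ℂ f v‖ ≤ C * ‖a‖) : ∃ g, (g, f) ∈ A := by
  have hwd : ∀ v v' a, (v, a) ∈ A.adjoint → (v', a) ∈ A.adjoint →
      inner ℂ f v = inner ℂ f v' := by
    intro v v' a h1 h2
    have h3 := h (v - v') 0 (by simpa using A.adjoint.sub_mem h1 h2)
    rw [norm_zero, mul_zero, norm_le_zero_iff, inner_sub_right] at h3
    exact sub_eq_zero.mp h3
  have hex : ∀ a : A.adjoint.map (LinearMap.snd ℂ H₂ H₁), ∃ v, (v, a.1) ∈ A.adjoint := by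
    rintro ⟨a, ⟨v, a'⟩, hp, rfl⟩
    exact ⟨v, hp⟩
  choose s hs using hex
  let φ : A.adjoint.map (LinearMap.snd ℂ H₂ H₁) →ₗ[ℂ] ℂ :=
    { toFun := fun a => inner ℂ f (s a)
      map_add' := by
        intro a b
        rw [← inner_add_right]
        exact hwd _ _ _ (hs (a + b)) (A.adjoint.add_mem (hs a) (hs b))
      map_smul' := by
        intro c a
        rw [RingHom.id_apply, smul_eq_mul, ← inner_smul_right]
        exact hwd _ _ _ (hs (c • a)) (A.adjoint.smul_mem c (hs a)) }
  obtain ⟨ψ, hψ, -⟩ := exists_extension_norm_eq (𝕜 := ℂ) _ (φ.mkContinuous C (fun a => h _ _ (hs a)))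
  refine ⟨(InnerProductSpace.toDual ℂ H₁).symm ψ, aux_double A hA _ _ fun v a hva => ?_⟩
  have hva' : (v, a) ∈ A.adjoint := by
    rw [Submodule.mem_adjoint_iff]
    intro x y hxy
    exact sub_eq_zero.mpr (hva x y hxy)
  rw [InnerProductSpace.toDual_symm_apply]
  have := hψ ⟨a, (v, a), hva', rfl⟩
  rw [this]
  exact hwd _ _ _ hva' (hs ⟨a, (v, a), hva', rfl⟩)


theorem aux_ii_i (A : Submodule ℂ (H₁ × H₂)) (hA : IsClosed (A : Set (H₁ × H₂)))
    (B : Submodule ℂ (H₂ × H₃)) (hB : IsClosed (B : Set (H₂ × H₃)))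
    (L : Submodule ℂ H₂)
    (hcl : IsClosed (((B ⊓ Lᗮ.comap (LinearMap.fst ℂ H₂ H₃)).map (LinearMap.snd ℂ H₂ H₃) :
      Submodule ℂ H₃) : Set H₃))
    (heq : A.map (LinearMap.snd ℂ H₁ H₂) ⊓ Lᗮ = B.comap (LinearMap.inl ℂ H₂ H₃) ⊓ Lᗮ) :
    ∃ c > (0 : ℝ), ∀ u a b, (u, a) ∈ A.adjoint → (u, b) ∈ B → u ∈ Lᗮ →
      c * ‖u‖ ^ 2 ≤ ‖a‖ ^ 2 + ‖b‖ ^ 2 := by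
  have hLc : IsClosed (Lᗮ : Set H₂) := L.isClosed_orthogonal
  have hKc : IsClosed ((B.comap (LinearMap.inl ℂ H₂ H₃) ⊓ Lᗮ : Submodule ℂ H₂) : Set H₂) :=
    (hB.preimage (continuous_id.prodMk continuous_const)).inter hLc
  obtain ⟨C₂, hC₂, h₂⟩ := aux_open _ (hB.inter (hLc.preimage continuous_fst)) hcl
  obtain ⟨C₁, hC₁, h₁⟩ := aux_open (A ⊓ Lᗮ.comap (LinearMap.snd ℂ H₁ H₂))
    (hA.inter (hLc.preimage continuous_snd)) (by
      convert hKc using 2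
      rw [← heq]
      apply le_antisymm
      · rintro _ ⟨p, ⟨h1, h2⟩, rfl⟩
        exact ⟨⟨p, h1, rfl⟩, h2⟩
      · rintro _ ⟨⟨p, h1, rfl⟩, h2⟩
        exact ⟨p, ⟨h1, h2⟩, rfl⟩)
  set M : Submodule ℂ H₂ := B.comap (LinearMap.inl ℂ H₂ H₃) ⊓ Lᗮ with hM
  have : CompleteSpace M := hKc.completeSpace_coe
  refine ⟨1 / (C₁ ^ 2 + C₂ ^ 2), by positivity, fun u a b hua hub huL => ?_⟩
  obtain ⟨k, hk, w, hw, rfl⟩ := M.exists_add_mem_mem_orthogonal u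
  have hkM := hk
  rw [hM, Submodule.mem_inf] at hk
  have hwL : w ∈ Lᗮ := by simpa using Lᗮ.sub_mem huL hk.2
  have hwB : (w, b) ∈ B := by
    have := B.sub_mem hub hk.1
    simpa using this
  have hwn : ‖w‖ ≤ C₂ * ‖b‖ := by
    obtain ⟨w', hw', hn⟩ := h₂ w b ⟨hwB, hwL⟩
    refine le_trans ?_ hn
    have hd : w' - w ∈ M := by
      refine ⟨?_, Lᗮ.sub_mem hw'.2 hwL⟩
      have := B.sub_mem hw'.1 hwB
      simpa using this
    have ho : inner ℂ (w' - w) w = 0 := hw _ hd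
    have := norm_add_sq_eq_norm_sq_add_norm_sq_of_inner_eq_zero _ _ ho
    rw [sub_add_cancel] at this
    nlinarith [norm_nonneg w, norm_nonneg w', mul_self_nonneg ‖w' - w‖]
  have hkn : ‖k‖ ≤ C₁ * ‖a‖ := by
    have hkR : k ∈ A.map (LinearMap.snd ℂ H₁ H₂) ⊓ Lᗮ := heq ▸ hkM
    obtain ⟨⟨⟨x, y⟩, hxy, rfl⟩, -⟩ := hkR
    obtain ⟨g, hg, hgn⟩ := h₁ x y ⟨hxy, hk.2⟩
    change ‖y‖ ≤ _
    have h3 := (Submodule.mem_adjoint_iff _ _).mp hua g y hg.1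
    have h4 : inner ℂ y w = 0 := hw _ hkM
    have h5 : inner ℂ y y = inner ℂ g a := by
      have := sub_eq_zero.mp h3
      simpa [inner_add_right, h4] using this
    have h6 : ‖y‖ * ‖y‖ ≤ ‖g‖ * ‖a‖ := by
      have h7 := norm_inner_le_norm (𝕜 := ℂ) g a
      rw [← h5, inner_self_eq_norm_sq_to_K] at h7
      simpa [pow_two] using h7
    by_contra hcon
    push Not at hcon
    have hy : 0 < ‖y‖ := lt_of_le_of_lt (by positivity) hcon
    have : ‖g‖ * ‖a‖ ≤ C₁ * ‖y‖ * ‖a‖ := by gcongr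
    nlinarith
  have ho : inner ℂ k w = 0 := hw _ hkM
  have hsq := norm_add_sq_eq_norm_sq_add_norm_sq_of_inner_eq_zero _ _ ho
  have h1 : ‖k‖ ^ 2 ≤ C₁ ^ 2 * ‖a‖ ^ 2 := by rw [← mul_pow]; gcongr
  have h2 : ‖w‖ ^ 2 ≤ C₂ ^ 2 * ‖b‖ ^ 2 := by rw [← mul_pow]; gcongr
  rw [one_div, inv_mul_le_iff₀ (by positivity)]
  nlinarith [sq_nonneg (C₁ * ‖b‖), sq_nonneg (C₂ * ‖a‖)]

theorem aux_i_ii (A : Submodule ℂ (H₁ × H₂)) (hA : IsClosed (A : Set (H₁ × H₂)))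
    (hS : IsClosed (A.adjoint : Set (H₂ × H₁)))
    (B : Submodule ℂ (H₂ × H₃)) (hB : IsClosed (B : Set (H₂ × H₃)))
    (hSs : ∀ y, ((0 : H₂), y) ∈ A.adjoint → y = 0)
    (hBs : ∀ y, ((0 : H₂), y) ∈ B → y = 0)
    (hRK : A.map (LinearMap.snd ℂ H₁ H₂) ≤ B.comap (LinearMap.inl ℂ H₂ H₃))
    (L : Submodule ℂ H₂) [FiniteDimensional ℂ L]
    (hLS : ∀ u ∈ L, ∃ a, (u, a) ∈ A.adjoint) (hLB : ∀ u ∈ L, ∃ b, (u, b) ∈ B)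
    (c : ℝ) (hc : 0 < c)
    (hest : ∀ u a b, (u, a) ∈ A.adjoint → (u, b) ∈ B → u ∈ Lᗮ →
      c * ‖u‖ ^ 2 ≤ ‖a‖ ^ 2 + ‖b‖ ^ 2) :
    ∃ N : Submodule ℂ H₂, FiniteDimensional ℂ N ∧
      (∀ u ∈ N, (u, 0) ∈ A.adjoint ∧ (u, 0) ∈ B) ∧
      IsClosed (((B ⊓ Nᗮ.comap (LinearMap.fst ℂ H₂ H₃)).map (LinearMap.snd ℂ H₂ H₃) :
        Submodule ℂ H₃) : Set H₃) ∧
      A.map (LinearMap.snd ℂ H₁ H₂) ⊓ Nᗮ = B.comap (LinearMap.inl ℂ H₂ H₃) ⊓ Nᗮ := by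
  set K : Submodule ℂ H₂ := B.comap (LinearMap.inl ℂ H₂ H₃) with hK
  have hKc : IsClosed (K : Set H₂) := hB.preimage (continuous_id.prodMk continuous_const)
  let N : Submodule ℂ H₂ := A.adjoint.comap (LinearMap.inl ℂ H₂ H₁) ⊓ K
  have hNc : IsClosed (N : Set H₂) :=
    (hS.preimage (continuous_id.prodMk continuous_const)).inter hKc
  have hN : ∀ u ∈ N, (u, 0) ∈ A.adjoint ∧ (u, 0) ∈ B := fun u hu => ⟨hu.1, hu.2⟩
  -- vectors orthogonal to the range of `A` lie in the kernel of the adjoint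
  have hperp : ∀ v, (∀ y ∈ A.map (LinearMap.snd ℂ H₁ H₂), inner ℂ y v = 0) →
      (v, 0) ∈ A.adjoint := by
    intro v hv
    rw [Submodule.mem_adjoint_iff]
    intro x y hxy
    simp only [inner_zero_right, sub_zero]
    exact hv y ⟨(x, y), hxy, rfl⟩
  have hNfin : FiniteDimensional ℂ N := by
    let f : N →ₗ[ℂ] L := L.orthogonalProjectionOnto.toLinearMap.comp N.subtype
    refine FiniteDimensional.of_injective f ?_
    rw [← LinearMap.ker_eq_bot, LinearMap.ker_eq_bot']
    rintro ⟨u, hu⟩ h0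
    have huL : u ∈ Lᗮ := by
      rw [← Submodule.orthogonalProjectionOnto_eq_zero_iff]
      exact h0
    have := hest u 0 0 hu.1 hu.2 huL
    have h1 : ‖u‖ ^ 2 ≤ 0 := by
      simp only [norm_zero] at this
      nlinarith [sq_nonneg ‖u‖]
    have h2 : ‖u‖ = 0 := by
      have := sq_nonneg ‖u‖
      exact pow_eq_zero_iff (two_ne_zero) |>.mp (le_antisymm h1 this)
    exact Subtype.ext (norm_eq_zero.mp h2)
  -- the graph of `(T₁*, T₂)`
  let V : Submodule ℂ (H₂ × (H₁ × H₃)) :=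
    A.adjoint.comap ((LinearMap.fst ℂ H₂ (H₁ × H₃)).prod
      ((LinearMap.fst ℂ H₁ H₃).comp (LinearMap.snd ℂ H₂ (H₁ × H₃)))) ⊓
    B.comap ((LinearMap.fst ℂ H₂ (H₁ × H₃)).prod
      ((LinearMap.snd ℂ H₁ H₃).comp (LinearMap.snd ℂ H₂ (H₁ × H₃))))
  have hVmem : ∀ u a b, (u, (a, b)) ∈ V ↔ (u, a) ∈ A.adjoint ∧ (u, b) ∈ B :=
    fun u a b => Iff.rfl
  have hVc : IsClosed (V : Set (H₂ × (H₁ × H₃))) :=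
    (hS.preimage (continuous_fst.prodMk (continuous_fst.comp continuous_snd))).inter
      (hB.preimage (continuous_fst.prodMk (continuous_snd.comp continuous_snd)))
  let VL := V ⊓ Lᗮ.comap (LinearMap.fst ℂ H₂ (H₁ × H₃))
  let VF := V ⊓ L.comap (LinearMap.fst ℂ H₂ (H₁ × H₃))
  have hVLc : IsClosed (VL : Set (H₂ × (H₁ × H₃))) :=
    hVc.inter (L.isClosed_orthogonal.preimage continuous_fst)
  have hVLr := aux_closed VL hVLc (Real.sqrt (2 / c)) (by
    rintro u ⟨a, b⟩ ⟨huV, huL⟩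
    have h1 := hest u a b huV.1 huV.2 huL
    have ha : ‖a‖ ≤ ‖(a, b)‖ := norm_fst_le (a, b)
    have hb : ‖b‖ ≤ ‖(a, b)‖ := norm_snd_le (a, b)
    rw [← Real.sqrt_sq (norm_nonneg (a, b)), ← Real.sqrt_mul (by positivity)]
    apply Real.le_sqrt_of_sq_le
    rw [div_mul_eq_mul_div, le_div_iff₀ hc]
    have ha2 : ‖a‖ ^ 2 ≤ ‖(a, b)‖ ^ 2 := by gcongr
    have hb2 : ‖b‖ ^ 2 ≤ ‖(a, b)‖ ^ 2 := by gcongr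
    linarith)
  have hVFfin : FiniteDimensional ℂ VF := by
    let f : VF →ₗ[ℂ] L := ((LinearMap.fst ℂ H₂ (H₁ × H₃)).comp VF.subtype).codRestrict L
      (fun p => p.2.2)
    refine FiniteDimensional.of_injective f ?_
    rw [← LinearMap.ker_eq_bot, LinearMap.ker_eq_bot']
    rintro ⟨⟨u, a, b⟩, hu⟩ h0
    have hu0 : u = 0 := congrArg Subtype.val h0
    subst hu0
    have h1 := hSs a hu.1.1
    have h2 := hBs b hu.1.2
    subst h1 h2
    rfl
  have hsup : V = VL ⊔ VF := by
    apply le_antisymm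
    · rintro ⟨u, a, b⟩ hu
      obtain ⟨l, hl, w, hw, rfl⟩ := L.exists_add_mem_mem_orthogonal u
      obtain ⟨a', ha'⟩ := hLS l hl
      obtain ⟨b', hb'⟩ := hLB l hl
      rw [Submodule.mem_sup]
      have hl' : (l, (a', b')) ∈ V := ⟨ha', hb'⟩
      have hd : (l + w, (a, b)) - (l, (a', b')) ∈ V := V.sub_mem hu hl'
      refine ⟨_, ⟨hd, ?_⟩, (l, (a', b')), ⟨hl', hl⟩, sub_add_cancel _ _⟩
      change l + w - l ∈ Lᗮ
      rwa [add_sub_cancel_left]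
    · exact sup_le inf_le_left inf_le_left
  have hVr : IsClosed ((V.map (LinearMap.snd ℂ H₂ (H₁ × H₃)) : Submodule ℂ (H₁ × H₃)) :
      Set (H₁ × H₃)) := by
    rw [hsup, Submodule.map_sup]
    exact Submodule.isClosed_sup_finiteDimensional _ _ hVLr
  obtain ⟨C, hC, hopen⟩ := aux_open V hVc hVr
  have hest' : ∀ u a b, (u, a) ∈ A.adjoint → (u, b) ∈ B → u ∈ Nᗮ →
      ‖u‖ ≤ C * ‖(a, b)‖ := by
    intro u a b hua hub hu
    obtain ⟨u', hu', hn⟩ := hopen u (a, b) ⟨hua, hub⟩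
    refine le_trans ?_ hn
    have hd : u' - u ∈ N := by
      refine ⟨?_, ?_⟩
      · have := A.adjoint.sub_mem hu'.1 hua
        simpa using this
      · have := B.sub_mem hu'.2 hub
        simpa [hK] using this
    have ho : inner ℂ (u' - u) u = 0 := hu _ hd
    have := norm_add_sq_eq_norm_sq_add_norm_sq_of_inner_eq_zero _ _ ho
    rw [sub_add_cancel] at this
    nlinarith [norm_nonneg u, norm_nonneg u', mul_self_nonneg ‖u' - u‖]
  have hKcomp : CompleteSpace K := hKc.completeSpace_coe
  refine ⟨N, hNfin, hN, ?_, ?_⟩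
  · have h1 := aux_closed (B ⊓ Kᗮ.comap (LinearMap.fst ℂ H₂ H₃))
      (hB.inter (K.isClosed_orthogonal.preimage continuous_fst)) C (by
        rintro x y ⟨hxB, hxK⟩
        have h2 := hest' x 0 y (hperp x fun r hr => hxK r (hRK hr)) hxB
          (fun n hn => hxK n hn.2)
        simpa [Prod.norm_def] using h2)
    convert h1 using 2
    apply le_antisymm
    · rintro _ ⟨⟨x, y⟩, ⟨hxB, hxN⟩, rfl⟩
      obtain ⟨k, hk, w, hw, rfl⟩ := K.exists_add_mem_mem_orthogonal x
      refine ⟨(w, y), ⟨?_, hw⟩, rfl⟩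
      have := B.sub_mem hxB hk
      simpa using this
    · rintro _ ⟨⟨x, y⟩, ⟨hxB, hxN⟩, rfl⟩
      exact ⟨(x, y), ⟨hxB, fun n hn => hxN n hn.2⟩, rfl⟩
  · apply le_antisymm
    · exact inf_le_inf_right _ hRK
    · intro f hf
      refine ⟨?_, hf.2⟩
      let M : Submodule ℂ H₂ := K ⊓ Nᗮ
      have hMc : IsClosed (M : Set H₂) := hKc.inter N.isClosed_orthogonal
      have : CompleteSpace M := hMc.completeSpace_coe
      have hRM : A.map (LinearMap.snd ℂ H₁ H₂) ≤ M := by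
        refine le_inf hRK ?_
        rintro _ ⟨⟨x, y⟩, hxy, rfl⟩
        rw [Submodule.mem_orthogonal']
        intro n hn
        have := (Submodule.mem_adjoint_iff _ _).mp hn.1 x y hxy
        simpa using this
      obtain ⟨g, hg⟩ := aux_solve A hA f (‖f‖ * C) (by
        intro v a hva
        obtain ⟨v₁, hv₁, v₂, hv₂, rfl⟩ := M.exists_add_mem_mem_orthogonal v
        have h2 : (v₂, 0) ∈ A.adjoint := hperp v₂ fun r hr => hv₂ r (hRM hr)
        have h1 : (v₁, a) ∈ A.adjoint := by
          have := A.adjoint.sub_mem hva h2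
          simpa using this
        have h3 := hest' v₁ a 0 h1 hv₁.1 hv₁.2
        have h4 : inner ℂ f v₂ = 0 := hv₂ f hf
        rw [inner_add_right, h4, add_zero, mul_assoc]
        refine (norm_inner_le_norm f v₁).trans ?_
        gcongr
        simpa [Prod.norm_def] using h3)
      exact ⟨(g, f), hg, rfl⟩

end SpectralAux



/-- For densely defined closed operators `T₁ : H₁ → H₂`, `T₂ : H₂ → H₃`
between complex Hilbert spaces with `range T₁ ⊆ ker T₂`, the estimate
`‖T₁*u‖² + ‖T₂u‖² ≥ c‖u‖²` holds on `dom T₁* ∩ dom T₂ ∩ L^⊥` for some `c > 0` and some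
finite-dimensional `L ⊆ dom T₁* ∩ dom T₂` if and only if there is a finite-dimensional
`L ⊆ dom T₁* ∩ dom T₂` such that the range of `T₂` restricted to `dom T₂ ∩ L^⊥` is closed
and `range T₁ ∩ L^⊥ = ker T₂ ∩ L^⊥`. -/
theorem spectral_lemma_part_two
    {H₁ H₂ H₃ : Type*}
    [NormedAddCommGroup H₁] [InnerProductSpace ℂ H₁] [CompleteSpace H₁]
    [NormedAddCommGroup H₂] [InnerProductSpace ℂ H₂] [CompleteSpace H₂]
    [NormedAddCommGroup H₃] [InnerProductSpace ℂ H₃] [CompleteSpace H₃]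
    (T₁ : H₁ →ₗ.[ℂ] H₂) (T₂ : H₂ →ₗ.[ℂ] H₃)
    (hT₁dense : Dense (T₁.domain : Set H₁)) (hT₂dense : Dense (T₂.domain : Set H₂))
    (hT₁closed : T₁.IsClosed) (hT₂closed : T₂.IsClosed)
    (hrange : LinearMap.range T₁.toFun ≤
      (LinearMap.ker T₂.toFun).map T₂.domain.subtype) :
    (∃ c > (0 : ℝ), ∃ L : Submodule ℂ H₂, FiniteDimensional ℂ L ∧
        (L : Set H₂) ⊆ (T₁†.domain : Set H₂) ∩ (T₂.domain : Set H₂) ∧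
        ∀ (u : H₂) (h1 : u ∈ T₁†.domain) (h2 : u ∈ T₂.domain), u ∈ Lᗮ →
          c * ‖u‖ ^ 2 ≤ ‖T₁† ⟨u, h1⟩‖ ^ 2 + ‖T₂ ⟨u, h2⟩‖ ^ 2) ↔
      (∃ L : Submodule ℂ H₂, FiniteDimensional ℂ L ∧
        (L : Set H₂) ⊆ (T₁†.domain : Set H₂) ∩ (T₂.domain : Set H₂) ∧
        IsClosed {v : H₃ | ∃ (u : H₂) (h : u ∈ T₂.domain), u ∈ Lᗮ ∧ T₂ ⟨u, h⟩ = v} ∧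
        LinearMap.range T₁.toFun ⊓ Lᗮ =
          (LinearMap.ker T₂.toFun).map T₂.domain.subtype ⊓ Lᗮ) := by
  have hSg := LinearPMap.adjoint_graph_eq_graph_adjoint hT₁dense
  have hSc : IsClosed (T₁.graph.adjoint : Set (H₂ × H₁)) :=
    hSg ▸ LinearPMap.adjoint_isClosed hT₁dense
  have hSs : ∀ y, ((0 : H₂), y) ∈ T₁.graph.adjoint → y = 0 := by
    intro y hy
    rw [← hSg] at hy
    exact LinearPMap.graph_fst_eq_zero_snd _ hy rfl
  have hBs : ∀ y, ((0 : H₂), y) ∈ T₂.graph → y = 0 :=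
    fun y hy => LinearPMap.graph_fst_eq_zero_snd _ hy rfl
  have hR : LinearMap.range T₁.toFun = T₁.graph.map (LinearMap.snd ℂ H₁ H₂) := by
    ext y
    constructor
    · rintro ⟨x, rfl⟩
      exact ⟨(x, T₁ x), T₁.mem_graph x, rfl⟩
    · rintro ⟨⟨x, y⟩, hxy, rfl⟩
      obtain ⟨x', -, h2⟩ := (LinearPMap.mem_graph_iff _).mp hxy
      exact ⟨x', h2⟩
  have hK : (LinearMap.ker T₂.toFun).map T₂.domain.subtype =
      T₂.graph.comap (LinearMap.inl ℂ H₂ H₃) := by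
    ext y
    constructor
    · rintro ⟨x, hx, rfl⟩
      have := T₂.mem_graph x
      have hx0 : T₂ x = 0 := hx
      rw [hx0] at this
      exact this
    · intro hy
      obtain ⟨x', h1, h2⟩ := (LinearPMap.mem_graph_iff _).mp hy
      exact ⟨x', h2, h1⟩
  have hset : ∀ L : Submodule ℂ H₂,
      {v : H₃ | ∃ (u : H₂) (h : u ∈ T₂.domain), u ∈ Lᗮ ∧ T₂ ⟨u, h⟩ = v} =
      (((T₂.graph ⊓ Lᗮ.comap (LinearMap.fst ℂ H₂ H₃)).map (LinearMap.snd ℂ H₂ H₃) :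
        Submodule ℂ H₃) : Set H₃) := by
    intro L
    ext v
    constructor
    · rintro ⟨u, h, hu, rfl⟩
      exact ⟨(u, T₂ ⟨u, h⟩), ⟨T₂.mem_graph ⟨u, h⟩, hu⟩, rfl⟩
    · rintro ⟨⟨u, v⟩, ⟨h1, h2⟩, rfl⟩
      obtain ⟨⟨u', hu'⟩, h3, h4⟩ := (LinearPMap.mem_graph_iff _).mp h1
      have h3' : u' = u := h3
      subst h3'
      exact ⟨u', hu', h2, h4⟩
  rw [hR, hK] at hrange
  simp only [hR, hK]
  constructor
  · rintro ⟨c, hc, L, hL, hLd, hest⟩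
    obtain ⟨N, hN, hNd, h1, h2⟩ := aux_i_ii T₁.graph hT₁closed hSc T₂.graph hT₂closed hSs hBs
      hrange L
      (fun u hu => ⟨T₁† ⟨u, (hLd hu).1⟩, hSg ▸ LinearPMap.mem_graph _ ⟨u, (hLd hu).1⟩⟩)
      (fun u hu => ⟨T₂ ⟨u, (hLd hu).2⟩, LinearPMap.mem_graph _ ⟨u, (hLd hu).2⟩⟩) c hc (by
        intro u a b ha hb hu
        rw [← hSg] at ha
        obtain ⟨⟨u', h1⟩, rfl, rfl⟩ := (LinearPMap.mem_graph_iff _).mp ha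
        obtain ⟨⟨u'', h2⟩, h3, rfl⟩ := (LinearPMap.mem_graph_iff _).mp hb
        have h3' : u'' = u' := h3
        subst h3'
        exact hest u'' h1 h2 hu)
    refine ⟨N, hN, fun u hu => ⟨?_, ?_⟩, (hset N).symm ▸ h1, h2⟩
    · have := (hNd u hu).1
      rw [← hSg] at this
      exact LinearPMap.mem_domain_of_mem_graph this
    · exact LinearPMap.mem_domain_of_mem_graph (hNd u hu).2
  · rintro ⟨L, hL, hLd, h1, h2⟩
    rw [hset L] at h1
    obtain ⟨c, hc, hest⟩ := aux_ii_i T₁.graph hT₁closed T₂.graph hT₂closed L h1 h2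
    refine ⟨c, hc, L, hL, hLd, fun u hu1 hu2 huL => ?_⟩
    exact hest u _ _ (hSg ▸ LinearPMap.mem_graph _ ⟨u, hu1⟩)
      (LinearPMap.mem_graph _ ⟨u, hu2⟩) huL
end

section
/- Let T₁ : H₁ → H₂ be as in the context. Then the following are equivalent: (i) there exist a constant c > 0 and a finite-dimensional subspace L ⊆ dom(T₁*) ∩ (ker T₁*)^⊥ such that ‖T₁*u‖ ≥ c‖u‖ for all u ∈ dom(T₁*) ∩ (ker T₁*)^⊥ ∩ L^⊥; (ii) there exists a finite-dimensional subspace L ⊆ (ker T₁*)^⊥ such that range(T₁) ∩ L^⊥ = (ker T₁*)^⊥ ∩ L^⊥. -/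
open scoped LinearPMap

section Aux
open Filter Topology

variable {H₁ H₂ : Type*}
    [NormedAddCommGroup H₁] [InnerProductSpace ℂ H₁] [CompleteSpace H₁]
    [NormedAddCommGroup H₂] [InnerProductSpace ℂ H₂] [CompleteSpace H₂]

theorem aux_mem_K (T : H₁ →ₗ.[ℂ] H₂) (u : H₂) :
    u ∈ (LinearMap.ker T†.toFun).map T†.domain.subtype ↔
      ∃ h : u ∈ T†.domain, T† ⟨u, h⟩ = 0 := by
  simp only [Submodule.mem_map, LinearMap.mem_ker, Subtype.exists]
  constructor
  · rintro ⟨a, h, h0, rfl⟩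
    exact ⟨h, h0⟩
  · rintro ⟨h, h0⟩
    exact ⟨u, h, h0, rfl⟩

theorem aux_mem_K_iff (T : H₁ →ₗ.[ℂ] H₂) (hd : Dense (T.domain : Set H₁)) (u : H₂) :
    u ∈ (LinearMap.ker T†.toFun).map T†.domain.subtype ↔
      u ∈ (LinearMap.range T.toFun)ᗮ := by
  rw [aux_mem_K, Submodule.mem_orthogonal']
  constructor
  · rintro ⟨h, h0⟩ _ ⟨x, rfl⟩
    have := LinearPMap.adjoint_isFormalAdjoint hd ⟨u, h⟩ x
    rw [h0, inner_zero_left] at this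
    exact this.symm
  · intro h
    have h' : ∀ x : T.domain, inner ℂ (0 : H₁) (x : H₁) = inner ℂ u (T x) := fun x => by
      rw [inner_zero_left]; exact (h _ ⟨x, rfl⟩).symm
    have hu := LinearPMap.mem_adjoint_domain_of_exists u ⟨0, h'⟩
    exact ⟨hu, LinearPMap.adjoint_apply_eq hd ⟨u, hu⟩ h'⟩

/-- `T** = T` in the form needed. -/
theorem aux_double_s3 (T : H₁ →ₗ.[ℂ] H₂) (hd : Dense (T.domain : Set H₁)) (hc : T.IsClosed)
    (x : H₁) (v : H₂) (h : ∀ u : T†.domain, inner ℂ x (T† u) = inner ℂ v (u : H₂)) :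
    v ∈ LinearMap.range T.toFun := by
  let G : Submodule ℂ (WithLp 2 (H₁ × H₂)) :=
    T.graph.comap (WithLp.linearEquiv 2 ℂ (H₁ × H₂)).toLinearMap
  have hG : IsClosed (G : Set (WithLp 2 (H₁ × H₂))) :=
    hc.preimage (WithLp.prod_continuous_ofLp 2 H₁ H₂)
  have key : WithLp.toLp 2 (x, v) ∈ Gᗮᗮ := by
    rw [Submodule.mem_orthogonal']
    intro z hz
    rw [Submodule.mem_orthogonal'] at hz
    have hz' : ∀ y : T.domain, inner ℂ (-z.fst) (y : H₁) = inner ℂ z.snd (T y) := by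
      intro y
      have := hz (WithLp.toLp 2 ((y : H₁), T y)) (T.mem_graph y)
      rw [WithLp.prod_inner_apply] at this
      simp only [inner_neg_left] at this ⊢
      exact neg_eq_of_add_eq_zero_right this
    have hm := LinearPMap.mem_adjoint_domain_of_exists z.snd ⟨_, hz'⟩
    have he := LinearPMap.adjoint_apply_eq hd ⟨z.snd, hm⟩ hz'
    have := h ⟨z.snd, hm⟩
    rw [he, inner_neg_right] at this
    rw [WithLp.prod_inner_apply]
    change inner ℂ x z.fst + inner ℂ v z.snd = 0
    rw [← this]; ring
  rw [Submodule.orthogonal_orthogonal_eq_closure, hG.submodule_topologicalClosure_eq] at key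
  obtain ⟨y, -, hy⟩ := (T.mem_graph_iff).1 key
  exact ⟨y, hy⟩

theorem aux_range_of_est (T : H₁ →ₗ.[ℂ] H₂) (hd : Dense (T.domain : Set H₁)) (hc : T.IsClosed)
    (C : ℝ) (v : H₂)
    (h : ∀ u : T†.domain, ‖inner ℂ v (u : H₂)‖ ≤ C * ‖T† u‖) :
    v ∈ LinearMap.range T.toFun := by
  -- functional on the range of the adjoint
  let f : T†.domain →ₗ[ℂ] ℂ := (innerₛₗ ℂ v).comp T†.domain.subtype
  let A : T†.domain →ₗ[ℂ] H₁ := T†.toFun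
  have hf : ∀ u, ‖f u‖ ≤ C * ‖A u‖ := h
  obtain ⟨s, hs⟩ := LinearMap.exists_rightInverse_of_surjective A.rangeRestrict
    (LinearMap.range_rangeRestrict A)
  have hs' : ∀ y, A (s y) = (y : H₁) := fun y =>
    congrArg Subtype.val (LinearMap.congr_fun hs y)
  let g : StrongDual ℂ (LinearMap.range A) := (f.comp s).mkContinuous C (fun y => by
    have := hf (s y)
    rw [hs'] at this
    exact this)
  have hg : ∀ u, g ⟨A u, u, rfl⟩ = f u := by
    intro u
    change f (s ⟨A u, u, rfl⟩) = f u
    have h1 := hf (s ⟨A u, u, rfl⟩ - u)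
    rw [map_sub A, hs', sub_self, norm_zero, mul_zero, map_sub] at h1
    exact sub_eq_zero.1 (norm_le_zero_iff.1 h1)
  obtain ⟨G, hG, -⟩ := exists_extension_norm_eq (LinearMap.range A) g
  refine aux_double_s3 T hd hc ((InnerProductSpace.toDual ℂ H₁).symm G) v (fun u => ?_)
  rw [InnerProductSpace.toDual_symm_apply]
  exact (hG ⟨A u, u, rfl⟩).trans (hg u)

theorem aux_est (T : H₁ →ₗ.[ℂ] H₂) (hd : Dense (T.domain : Set H₁))
    (c : ℝ) (hc : 0 < c) (L : Submodule ℂ H₂) [FiniteDimensional ℂ L]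
    (hL : L ≤ T†.domain) (hLK : L ≤ ((LinearMap.ker T†.toFun).map T†.domain.subtype)ᗮ)
    (h : ∀ (u : H₂) (h1 : u ∈ T†.domain),
          u ∈ ((LinearMap.ker T†.toFun).map T†.domain.subtype)ᗮ → u ∈ Lᗮ →
            c * ‖u‖ ≤ ‖T† ⟨u, h1⟩‖) :
    ∃ C : ℝ, 0 ≤ C ∧ ∀ (u : H₂) (h1 : u ∈ T†.domain),
          u ∈ ((LinearMap.ker T†.toFun).map T†.domain.subtype)ᗮ →
            ‖u‖ ≤ C * ‖T† ⟨u, h1⟩‖ := by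
  set K := (LinearMap.ker T†.toFun).map T†.domain.subtype with hK
  by_contra hcon
  push Not at hcon
  have step : ∀ n : ℕ, ∃ u : T†.domain, (u : H₂) ∈ Kᗮ ∧ ‖(u : H₂)‖ = 1 ∧
      ‖T† u‖ ≤ 1 / ((n : ℝ) + 1) := by
    intro n
    obtain ⟨u, h1, hu, hlt⟩ := hcon ((n : ℝ) + 1) (by positivity)
    have hpos : 0 < ‖u‖ := lt_of_le_of_lt (by positivity) hlt
    refine ⟨((‖u‖⁻¹ : ℝ) : ℂ) • ⟨u, h1⟩, ?_, ?_, ?_⟩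
    · exact Kᗮ.smul_mem _ hu
    · change ‖((‖u‖⁻¹ : ℝ) : ℂ) • u‖ = 1
      rw [norm_smul, Complex.norm_real, norm_inv, norm_norm, inv_mul_cancel₀ hpos.ne']
    · rw [LinearPMap.map_smul, norm_smul, Complex.norm_real, norm_inv, norm_norm,
        le_div_iff₀ (by positivity), mul_assoc, inv_mul_le_iff₀ hpos, mul_one, mul_comm]
      exact hlt.le
  choose u huK hu1 hun using step
  have hT0 : Tendsto (fun n => T† (u n)) atTop (𝓝 0) :=
    squeeze_zero_norm hun tendsto_one_div_add_atTop_nhds_zero_nat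
  haveI : ProperSpace L := FiniteDimensional.proper ℂ L
  let l : ℕ → L := fun n => L.orthogonalProjectionOnto (u n : H₂)
  have hl : ∀ n, l n ∈ Metric.closedBall (0 : L) 1 := by
    intro n
    rw [mem_closedBall_zero_iff, ← hu1 n]
    exact L.norm_orthogonalProjectionOnto_apply_le _
  obtain ⟨l₀, -, φ, hφ, hlim⟩ := (isCompact_closedBall (0 : L) 1).tendsto_subseq hl
  let B : L →ₗ[ℂ] H₁ := T†.toFun.comp (Submodule.inclusion hL)
  have hB : Continuous B := LinearMap.continuous_of_finiteDimensional B
  let w : ℕ → T†.domain := fun n => u (φ n) - Submodule.inclusion hL (l (φ n))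
  have hTw : ∀ n, T† (w n) = T† (u (φ n)) - B (l (φ n)) := fun n => T†.map_sub _ _
  have hwlim : Tendsto (fun n => T† (w n)) atTop (𝓝 (0 - B l₀)) := by
    simp only [hTw]
    exact (hT0.comp hφ.tendsto_atTop).sub ((hB.tendsto l₀).comp hlim)
  have hwK : ∀ n, (w n : H₂) ∈ Kᗮ := fun n => Kᗮ.sub_mem (huK _) (hLK (l (φ n)).2)
  have hwL : ∀ n, (w n : H₂) ∈ Lᗮ := fun n => L.sub_starProjection_mem_orthogonal _
  have hdist : ∀ m n, c * dist (w m : H₂) (w n : H₂) ≤ dist (T† (w m)) (T† (w n)) := by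
    intro m n
    rw [dist_eq_norm, dist_eq_norm, ← T†.map_sub]
    exact h _ (w m - w n).2 (Kᗮ.sub_mem (hwK m) (hwK n)) (Lᗮ.sub_mem (hwL m) (hwL n))
  have hcau : CauchySeq (fun n => (w n : H₂)) := by
    rw [Metric.cauchySeq_iff]
    intro ε hε
    obtain ⟨N, hN⟩ := Metric.cauchySeq_iff.1 hwlim.cauchySeq (c * ε) (by positivity)
    refine ⟨N, fun m hm n hn => ?_⟩
    exact lt_of_mul_lt_mul_left ((hdist m n).trans_lt (hN m hm n hn)) hc.le
  obtain ⟨w₀, hw₀⟩ := cauchySeq_tendsto_of_complete hcau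
  have hulim : Tendsto (fun n => (u (φ n) : H₂)) atTop (𝓝 (w₀ + l₀)) := by
    have h2 : Tendsto (fun n => ((l (φ n) : L) : H₂)) atTop (𝓝 (l₀ : H₂)) :=
      (continuous_subtype_val.tendsto l₀).comp hlim
    refine (hw₀.add h2).congr (fun n => ?_)
    exact sub_add_cancel _ _
  have hgr : (w₀ + (l₀ : H₂), (0 : H₁)) ∈ T†.graph := by
    have hcl : IsClosed (T†.graph : Set (H₂ × H₁)) := LinearPMap.adjoint_isClosed hd
    refine hcl.mem_of_tendsto (hulim.prodMk_nhds (hT0.comp hφ.tendsto_atTop))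
      (Eventually.of_forall fun n => T†.mem_graph (u (φ n)))
  obtain ⟨y, hy1, hy2⟩ := T†.mem_graph_iff.1 hgr
  have hyK : w₀ + (l₀ : H₂) ∈ K := by
    rw [hK, aux_mem_K]
    simp only at hy1 hy2
    rw [← hy1]
    exact ⟨y.2, hy2⟩
  have hyK' : w₀ + (l₀ : H₂) ∈ Kᗮ :=
    K.isClosed_orthogonal.mem_of_tendsto hulim (Eventually.of_forall fun n => huK _)
  have h0 : w₀ + (l₀ : H₂) = 0 := inner_self_eq_zero.1 (Submodule.inner_right_of_mem_orthogonal hyK hyK')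
  have hn := hulim.norm
  simp only [hu1, h0, norm_zero] at hn
  exact one_ne_zero (tendsto_nhds_unique tendsto_const_nhds hn)

theorem aux_bs (T : H₁ →ₗ.[ℂ] H₂) (hd : Dense (T.domain : Set H₁))
    (hR : ((LinearMap.ker T†.toFun).map T†.domain.subtype)ᗮ ≤ LinearMap.range T.toFun) :
    ∃ c > (0 : ℝ), ∀ (u : H₂) (h1 : u ∈ T†.domain),
          u ∈ ((LinearMap.ker T†.toFun).map T†.domain.subtype)ᗮ →
            c * ‖u‖ ≤ ‖T† ⟨u, h1⟩‖ := by
  set K := (LinearMap.ker T†.toFun).map T†.domain.subtype with hK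
  let ι := {u : T†.domain // (u : H₂) ∈ Kᗮ ∧ ‖T† u‖ ≤ 1}
  let g : ι → H₂ →L[ℂ] ℂ := fun i => innerSL ℂ (i.1 : H₂)
  obtain ⟨C, hC⟩ : ∃ C, ∀ i, ‖g i‖ ≤ C := by
    apply banach_steinhaus
    intro v
    have hv := hR (Kᗮ.starProjection_apply_mem v)
    obtain ⟨x, hx⟩ := hv
    refine ⟨‖(x : H₁)‖, fun i => ?_⟩
    have h1 : inner ℂ (i.1 : H₂) v = inner ℂ (i.1 : H₂) (T x) := by
      have h2 := (Kᗮ).sub_starProjection_mem_orthogonal v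
      have h3 := Submodule.inner_right_of_mem_orthogonal i.2.1 h2
      rw [← hx, inner_sub_right, sub_eq_zero] at h3
      exact h3
    change ‖inner ℂ (i.1 : H₂) v‖ ≤ _
    rw [h1, ← LinearPMap.adjoint_isFormalAdjoint hd i.1 x]
    calc _ ≤ ‖T† i.1‖ * ‖(x : H₁)‖ := norm_inner_le_norm _ _
      _ ≤ 1 * ‖(x : H₁)‖ := by gcongr; exact i.2.2
      _ = _ := one_mul _
  have hC' : ∀ (u : T†.domain), (u : H₂) ∈ Kᗮ → ‖T† u‖ ≤ 1 → ‖(u : H₂)‖ ≤ C := by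
    intro u h1 h2
    have := hC ⟨u, h1, h2⟩
    simpa [g] using this
  have hC0 : 0 ≤ C := by simpa using hC' 0 (Kᗮ.zero_mem) (by simp)
  refine ⟨(C + 1)⁻¹, by positivity, fun u h1 hu => ?_⟩
  rw [inv_mul_le_iff₀ (by positivity)]
  by_cases h0 : T† ⟨u, h1⟩ = 0
  · have hk : u ∈ K := (aux_mem_K T u).2 ⟨h1, h0⟩
    have : u = 0 := inner_self_eq_zero.1 (Submodule.inner_right_of_mem_orthogonal hk hu)
    rw [h0, this, norm_zero, norm_zero, mul_zero]
  · have hpos : 0 < ‖T† ⟨u, h1⟩‖ := norm_pos_iff.2 h0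
    have := hC' (((‖T† ⟨u, h1⟩‖⁻¹ : ℝ) : ℂ) • ⟨u, h1⟩) (Kᗮ.smul_mem _ hu) (by
      rw [LinearPMap.map_smul, norm_smul, Complex.norm_real, norm_inv, norm_norm,
        inv_mul_cancel₀ hpos.ne'])
    change ‖((‖T† ⟨u, h1⟩‖⁻¹ : ℝ) : ℂ) • u‖ ≤ C at this
    rw [norm_smul, Complex.norm_real, norm_inv, norm_norm, inv_mul_le_iff₀ hpos] at this
    nlinarith

theorem aux_range (T : H₁ →ₗ.[ℂ] H₂) (hd : Dense (T.domain : Set H₁))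
    (L : Submodule ℂ H₂) [FiniteDimensional ℂ L]
    (h : ((LinearMap.ker T†.toFun).map T†.domain.subtype)ᗮ ⊓ Lᗮ ≤ LinearMap.range T.toFun) :
    ((LinearMap.ker T†.toFun).map T†.domain.subtype)ᗮ ≤ LinearMap.range T.toFun := by
  have hRK : LinearMap.range T.toFun ≤ ((LinearMap.ker T†.toFun).map T†.domain.subtype)ᗮ := by
    intro r hr
    rw [Submodule.mem_orthogonal']
    intro k hk
    exact Submodule.inner_right_of_mem_orthogonal hr ((aux_mem_K_iff T hd k).1 hk)
  intro v hv
  have hvc : v ∈ (LinearMap.range T.toFun).topologicalClosure := by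
    rw [← Submodule.orthogonal_orthogonal_eq_closure]
    exact Submodule.orthogonal_le (fun k hk => (aux_mem_K_iff T hd k).2 hk) hv
  let M : Submodule ℂ L := (LinearMap.range T.toFun).map (L.orthogonalProjectionOnto : H₂ →ₗ[ℂ] L)
  have hM : IsClosed (M : Set L) := M.closed_of_finiteDimensional
  have hPv : L.orthogonalProjectionOnto v ∈ M := by
    have : L.orthogonalProjectionOnto v ∈ closure (M : Set L) :=
      map_mem_closure L.orthogonalProjectionOnto.continuous hvc (fun r hr => ⟨r, hr, rfl⟩)
    rwa [hM.closure_eq] at this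
  obtain ⟨r, hr, hrv⟩ := hPv
  have hd' : v - r ∈ Lᗮ := by
    have h1 := L.sub_starProjection_mem_orthogonal (v - r)
    have h2 : L.starProjection (v - r) = 0 := by
      rw [map_sub, sub_eq_zero]
      exact congrArg Subtype.val hrv.symm
    rwa [h2, sub_zero] at h1
  have := h ⟨Submodule.sub_mem _ hv (hRK hr), hd'⟩
  simpa using Submodule.add_mem _ this hr

end Aux


/-- For a densely defined closed operator `T₁ : H₁ → H₂` between complex
Hilbert spaces, the estimate `‖T₁*u‖ ≥ c‖u‖` on `dom T₁* ∩ (ker T₁*)^⊥ ∩ L^⊥` holds for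
some `c > 0` and some finite-dimensional `L ⊆ dom T₁* ∩ (ker T₁*)^⊥` if and only if there
is a finite-dimensional `L ⊆ (ker T₁*)^⊥` with `range T₁ ∩ L^⊥ = (ker T₁*)^⊥ ∩ L^⊥`. -/
theorem spectral_lemma_remark_part_two
    {H₁ H₂ : Type*}
    [NormedAddCommGroup H₁] [InnerProductSpace ℂ H₁] [CompleteSpace H₁]
    [NormedAddCommGroup H₂] [InnerProductSpace ℂ H₂] [CompleteSpace H₂]
    (T₁ : H₁ →ₗ.[ℂ] H₂)
    (hT₁dense : Dense (T₁.domain : Set H₁)) (hT₁closed : T₁.IsClosed) :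
    (∃ c > (0 : ℝ), ∃ L : Submodule ℂ H₂, FiniteDimensional ℂ L ∧
        (L : Set H₂) ⊆ (T₁†.domain : Set H₂) ∩
          ((((LinearMap.ker T₁†.toFun).map T₁†.domain.subtype)ᗮ : Submodule ℂ H₂) : Set H₂) ∧
        ∀ (u : H₂) (h1 : u ∈ T₁†.domain),
          u ∈ ((LinearMap.ker T₁†.toFun).map T₁†.domain.subtype)ᗮ → u ∈ Lᗮ →
            c * ‖u‖ ≤ ‖T₁† ⟨u, h1⟩‖) ↔
      (∃ L : Submodule ℂ H₂, FiniteDimensional ℂ L ∧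
        L ≤ ((LinearMap.ker T₁†.toFun).map T₁†.domain.subtype)ᗮ ∧
        LinearMap.range T₁.toFun ⊓ Lᗮ =
          ((LinearMap.ker T₁†.toFun).map T₁†.domain.subtype)ᗮ ⊓ Lᗮ) := by
  constructor
  · rintro ⟨c, hc, L, hfd, hL, h⟩
    obtain ⟨C, hC0, hC⟩ := aux_est T₁ hT₁dense c hc L (fun x hx => (hL hx).1)
      (fun x hx => (hL hx).2) h
    refine ⟨⊥, inferInstance, bot_le, ?_⟩
    rw [Submodule.bot_orthogonal_eq_top, inf_top_eq, inf_top_eq]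
    set K := (LinearMap.ker T₁†.toFun).map T₁†.domain.subtype with hK
    have hKR : K = (LinearMap.range T₁.toFun)ᗮ := by
      ext u
      exact aux_mem_K_iff T₁ hT₁dense u
    refine le_antisymm ?_ ?_
    · rw [hKR]
      exact Submodule.le_orthogonal_orthogonal _
    · intro v hv
      refine aux_range_of_est T₁ hT₁dense hT₁closed (‖v‖ * C) v (fun u => ?_)
      haveI : CompleteSpace K := by
        rw [hKR]; infer_instance
      obtain ⟨hk, hk0⟩ := (aux_mem_K T₁ _).1 (K.starProjection_apply_mem (u : H₂))
      have hw := K.sub_starProjection_mem_orthogonal (u : H₂)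
      have e1 : T₁† (u - ⟨_, hk⟩) = T₁† u := by
        rw [LinearPMap.map_sub, hk0, sub_zero]
      have e2 := hC _ (u - ⟨_, hk⟩).2 hw
      have e3 : inner ℂ v (u : H₂) = inner ℂ v ((u : H₂) - K.starProjection (u : H₂)) := by
        rw [inner_sub_right, Submodule.inner_left_of_mem_orthogonal
          (K.starProjection_apply_mem (u : H₂)) hv, sub_zero]
      rw [e3, mul_assoc, ← e1]
      exact (norm_inner_le_norm _ _).trans (mul_le_mul_of_nonneg_left e2 (norm_nonneg _))
  · rintro ⟨L, hfd, hL, h⟩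
    obtain ⟨c, hc, hest⟩ := aux_bs T₁ hT₁dense
      (aux_range T₁ hT₁dense L (h.ge.trans inf_le_left))
    refine ⟨c, hc, ⊥, inferInstance, ?_, fun u h1 h2 _ => hest u h1 h2⟩
    intro x hx
    rw [SetLike.mem_coe, Submodule.mem_bot] at hx
    subst hx
    exact ⟨Submodule.zero_mem _, Submodule.zero_mem _⟩
end
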